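/- arXiv:0912.5358 — 11 statements merged into one kernel-verified Lean document; each statement's English description precedes it below -/
import Mathlib

section
/- For every natural number n and every real number x, ∑_{k=0}^{n} C(n,k) · C(n+k,k) · x^k = ∑_{k=0}^{n} C(n,k) · C(n+k,k) · (−1)^{n−k} · (x+1)^k, where C(·,·) denotes the usual binomial coefficient of natural numbers. -/
open Finset

lemma aeval_shiftedLegendre_real (n : ℕ) (y : ℝ) :
    Polynomial.aeval y (Polynomial.shiftedLegendre n) =
      ∑ k ∈ Finset.range (n + 1),
        (-1) ^ k * (n.choose k : ℝ) * ((n + k).choose k : ℝ) * y ^ k := by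
  rw [Polynomial.shiftedLegendre, map_sum]
  refine Finset.sum_congr rfl fun k _ => ?_
  rw [← Nat.choose_symm_add (a := n) (b := k), map_mul, Polynomial.aeval_C, map_pow,
    Polynomial.aeval_X]
  simp

/-- Simons' identity. -/
theorem simons_identity (n : ℕ) (x : ℝ) :
    ∑ k ∈ Finset.range (n + 1), (n.choose k : ℝ) * ((n + k).choose k : ℝ) * x ^ k =
    ∑ k ∈ Finset.range (n + 1),
      (n.choose k : ℝ) * ((n + k).choose k : ℝ) * (-1) ^ (n - k) * (x + 1) ^ k := by
  have h := Polynomial.shiftedLegendre_eval_symm n (-x)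
  rw [aeval_shiftedLegendre_real, aeval_shiftedLegendre_real, Finset.mul_sum] at h
  convert h using 2 with k hk k hk
  · have e : ((-1 : ℝ)) ^ k * (-1) ^ k = 1 := by rw [← mul_pow]; simp
    rw [neg_pow x k]
    linear_combination (-(n.choose k : ℝ) * ((n + k).choose k : ℝ) * x ^ k) * e
  · have hk' : k ≤ n := Nat.lt_succ_iff.mp (Finset.mem_range.mp hk)
    have e : ((-1 : ℝ)) ^ k * (-1) ^ k = 1 := by rw [← mul_pow]; simp
    have e2 : ((-1 : ℝ)) ^ n = (-1) ^ (n - k) * (-1) ^ k := by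
      rw [← pow_add, Nat.sub_add_cancel hk']
    rw [e2, show (1 : ℝ) - -x = x + 1 by ring]
    linear_combination
      (-(n.choose k : ℝ) * ((n + k).choose k : ℝ) * (-1) ^ (n - k) * (x + 1) ^ k) * e
end

section
/- For every real number α, every real number x, and every positive integer n, ∑_{k=0}^{n} C(n,k) · B(α+k,k) · x^k = ∑_{k=0}^{n} B(α,n−k) · B(α+k,k) · (−1)^{n−k} · (x+1)^k. -/
open Finset

/-- The generalized binomial coefficient `B(α, k) = (∏_{i=0}^{k-1} (α - i)) / k!`. -/
noncomputable def genBinom (α : ℝ) (k : ℕ) : ℝ :=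
  (∏ i ∈ Finset.range k, (α - i)) / k.factorial

theorem genBinom_eq_choose (a : ℝ) (k : ℕ) : genBinom a k = Ring.choose a k := by
  have h := Ring.descPochhammer_eq_factorial_smul_choose a k
  have h2 : (descPochhammer ℤ k).smeval a = ∏ i ∈ Finset.range k, (a - i) := by
    induction k with
    | zero => simp
    | succ k ih =>
      rw [descPochhammer_succ_right, Polynomial.smeval_mul,
        ih (Ring.descPochhammer_eq_factorial_smul_choose a k), Finset.prod_range_succ]
      simp [Polynomial.smeval_sub, Polynomial.smeval_natCast]
  have hk : (k.factorial : ℝ) ≠ 0 := by positivity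
  rw [genBinom, ← h2, h, nsmul_eq_mul]
  field_simp

theorem ring_choose_neg (r : ℝ) (n : ℕ) :
    Ring.choose (-r) n = (-1) ^ n * Ring.choose (r + n - 1) n := by
  rw [Ring.choose_neg]
  simp [Int.negOnePow_def, Units.smul_def]

theorem vandermonde_aux (a : ℝ) (j m : ℕ) :
    ∑ p ∈ antidiagonal m, Ring.choose a p.1 * (-1) ^ p.1 * Ring.choose (a + j + p.2) p.2
      = ((j + m).choose j : ℝ) := by
  have h := Ring.add_choose_eq (r := a) (s := -(a + j + 1)) m (Commute.all _ _)
  rw [show a + -(a + j + 1) = -((j : ℝ) + 1) by ring, ring_choose_neg,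
    show (j : ℝ) + 1 + m - 1 = ((j + m : ℕ) : ℝ) by push_cast; ring, Ring.choose_natCast] at h
  have hs : (j + m).choose j = (j + m).choose m := Nat.choose_symm_add
  have h1 : ((-1 : ℝ) ^ m) * (-1) ^ m = 1 := by
    rw [← mul_pow]; simp
  have hC : (((j + m).choose m : ℕ) : ℝ) = (-1) ^ m * ((-1) ^ m * ((j + m).choose m : ℕ)) := by
    rw [← mul_assoc, h1, one_mul]
  rw [hs, hC, h, Finset.mul_sum]
  refine Finset.sum_congr rfl fun p hp => ?_
  have hp : p.1 + p.2 = m := by simpa using hp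
  have h2 : ((-1 : ℝ) ^ p.2) * (-1) ^ p.2 = 1 := by
    rw [← mul_pow]; simp
  rw [ring_choose_neg, ← hp, pow_add,
    show a + (j : ℝ) + 1 + p.2 - 1 = a + j + p.2 by ring]
  linear_combination (-Ring.choose a p.1 * (-1) ^ p.1 * Ring.choose (a + j + p.2) p.2) * h2

theorem coeff_aux (a : ℝ) (n j : ℕ) (hj : j ≤ n) :
    ∑ k ∈ Finset.range (n + 1), Ring.choose a (n - k) * Ring.choose (a + k) k * (-1) ^ (n - k)
      * (k.choose j : ℝ) = (n.choose j : ℝ) * Ring.choose (a + j) j := by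
  obtain ⟨m, rfl⟩ := Nat.exists_eq_add_of_le hj
  rw [add_assoc, Finset.sum_range_add, Finset.sum_eq_zero, zero_add, ← vandermonde_aux a j m,
    ← Finset.Nat.sum_antidiagonal_swap, Finset.Nat.sum_antidiagonal_eq_sum_range_succ_mk,
    Finset.sum_mul]
  · refine Finset.sum_congr rfl fun b hb => ?_
    have h := Ring.choose_smul_choose (a + ((j + b : ℕ) : ℝ)) (n := j + b) (k := b) (by omega)
    rw [nsmul_eq_mul, Nat.add_sub_cancel, ← Nat.choose_symm_add,
      show a + ((j + b : ℕ) : ℝ) - b = a + j by push_cast; ring] at h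
    have e : j + m - (j + b) = m - b := by omega
    have e2 : a + ((j + b : ℕ) : ℝ) = a + j + b := by push_cast; ring
    rw [e2] at h
    simp only [Prod.swap, e, e2]
    linear_combination (Ring.choose a (m - b) * (-1) ^ (m - b)) * h
  · intro k hk
    rw [Nat.choose_eq_zero_of_lt (Finset.mem_range.mp hk)]
    simp

/-- Extension of Simons' identity (Proposition 2). -/
theorem simons_identity_ext (α x : ℝ) (n : ℕ) (hn : 0 < n) :
    ∑ k ∈ Finset.range (n + 1), (n.choose k : ℝ) * genBinom (α + k) k * x ^ k =
    ∑ k ∈ Finset.range (n + 1),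
      genBinom α (n - k) * genBinom (α + k) k * (-1) ^ (n - k) * (x + 1) ^ k := by
  simp only [genBinom_eq_choose]
  have hx : ∀ k ∈ Finset.range (n + 1),
      (x + 1) ^ k = ∑ j ∈ Finset.range (n + 1), (k.choose j : ℝ) * x ^ j := by
    intro k hk
    rw [add_pow]
    have hk' : k + 1 ≤ n + 1 := Finset.mem_range.mp hk
    refine (Finset.sum_subset (Finset.range_subset_range.mpr hk') ?_).trans ?_
    · intro j _ hj
      rw [Nat.choose_eq_zero_of_lt (by rw [Finset.mem_range] at hj; omega)]
      simp
    · exact Finset.sum_congr rfl fun j _ => by simp [mul_comm]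
  symm
  refine (Finset.sum_congr rfl fun k hk => by rw [hx k hk, Finset.mul_sum]).trans ?_
  rw [Finset.sum_comm]
  refine Finset.sum_congr rfl fun j hj => ?_
  rw [← coeff_aux α n j (by rw [Finset.mem_range] at hj; omega), Finset.sum_mul]
  exact Finset.sum_congr rfl fun k _ => by ring
end

section
/- For all positive integers q and n with q ≥ n and all real numbers x, y, ∑_{k=0}^{n} C(n,k) · C(q,k) · x^{n−k} · y^k = ∑_{k=0}^{n} C(n,k) · C(q+k,k) · (x−y)^{n−k} · y^k. -/
open Finset

/-- A form of the Vandermonde convolution. -/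
theorem aux_vandermonde (q k n : ℕ) (hk : k ≤ n) :
    (q + k).choose k = ∑ j ∈ Finset.range (n + 1), q.choose j * k.choose j := by
  rw [Nat.add_choose_eq, Finset.Nat.sum_antidiagonal_eq_sum_range_succ_mk]
  rw [← Finset.sum_subset (Finset.range_mono (Nat.succ_le_succ hk))]
  · refine Finset.sum_congr rfl fun j hj => ?_
    rw [Finset.mem_range] at hj
    simp only
    rw [Nat.choose_symm (by omega)]
  · intro j _ hj
    rw [Finset.mem_range] at hj
    rw [Nat.choose_eq_zero_of_lt (n := k) (by omega), mul_zero]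

/-- The inner sum collapses by the binomial theorem. -/
theorem aux_inner (n j : ℕ) (hj : j ≤ n) (x y : ℝ) :
    ∑ k ∈ Finset.range (n + 1),
      (n.choose k : ℝ) * (k.choose j : ℝ) * (x - y) ^ (n - k) * y ^ k =
    (n.choose j : ℝ) * x ^ (n - j) * y ^ j := by
  obtain ⟨m, rfl⟩ := Nat.exists_eq_add_of_le hj
  rw [add_assoc, Finset.sum_range_add, Finset.sum_eq_zero, zero_add]
  · have h := add_pow y (x - y) m
    rw [add_sub_cancel] at h
    rw [Nat.add_sub_cancel_left, h, Finset.mul_sum, Finset.sum_mul]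
    refine Finset.sum_congr rfl fun i _ => ?_
    have h2 : ((j + m).choose (j + i) : ℝ) * ((j + i).choose j : ℝ)
        = ((j + m).choose j : ℝ) * (m.choose i : ℝ) := by
      have := Nat.choose_mul (n := j + m) (k := j + i) (s := j) (by omega)
      rw [Nat.add_sub_cancel_left, Nat.add_sub_cancel_left] at this
      exact_mod_cast this
    rw [h2, Nat.add_sub_add_left]
    ring
  · intro k hk
    rw [Finset.mem_range] at hk
    rw [Nat.choose_eq_zero_of_lt hk]
    simp

/-- Ljunggren's identity. -/
theorem ljunggren_identity (q n : ℕ) (hn : 0 < n) (hq : n ≤ q) (x y : ℝ) :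
    ∑ k ∈ Finset.range (n + 1),
      (n.choose k : ℝ) * (q.choose k : ℝ) * x ^ (n - k) * y ^ k =
    ∑ k ∈ Finset.range (n + 1),
      (n.choose k : ℝ) * ((q + k).choose k : ℝ) * (x - y) ^ (n - k) * y ^ k := by
  have h : ∀ k ∈ Finset.range (n + 1),
      (n.choose k : ℝ) * ((q + k).choose k : ℝ) * (x - y) ^ (n - k) * y ^ k =
      ∑ j ∈ Finset.range (n + 1), (q.choose j : ℝ) *
        ((n.choose k : ℝ) * (k.choose j : ℝ) * (x - y) ^ (n - k) * y ^ k) := by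
    intro k hk
    rw [Finset.mem_range] at hk
    rw [aux_vandermonde q k n (by omega)]
    push_cast
    rw [Finset.mul_sum, Finset.sum_mul, Finset.sum_mul]
    exact Finset.sum_congr rfl fun j _ => by ring
  rw [Finset.sum_congr rfl h, Finset.sum_comm]
  refine Finset.sum_congr rfl fun j hj => ?_
  rw [Finset.mem_range] at hj
  rw [← Finset.mul_sum, aux_inner n j (by omega)]
  ring
end

section
/- For every natural number n and every real number x, ∑_{k=0}^{n} C(n,k) · C(n+k,k) · (−1)^{n−k} · (x+1)^k = ∑_{k=0}^{n} C(n,k)^2 · x^{n−k} · (x+1)^k. -/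
open Finset

open Polynomial in
theorem rodrigues_leibniz (n : ℕ) :
    (n.factorial : ℤ[X]) * shiftedLegendre n =
      (n.factorial : ℤ[X]) * (C ((-1 : ℤ) ^ n) * ∑ k ∈ Finset.range (n + 1),
        (n.choose k : ℤ[X]) ^ 2 * (X - C 1) ^ (n - k) * X ^ k) := by
  have h : (X ^ n * (1 - (X : ℤ[X])) ^ n) = C ((-1 : ℤ) ^ n) * (X ^ n * (X - C 1) ^ n) := by
    have : (1 - (X : ℤ[X])) = C (-1) * (X - C 1) := by simp
    rw [this, mul_pow, C_pow]
    ring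
  rw [factorial_mul_shiftedLegendre_eq, h, iterate_derivative_C_mul, iterate_derivative_mul,
    mul_left_comm, Finset.mul_sum (a := (n.factorial : ℤ[X]))]
  congr 1
  refine Finset.sum_congr rfl fun k hk => ?_
  have hk : k ≤ n := by simpa [Nat.lt_succ_iff] using hk
  rw [iterate_derivative_X_pow_eq_natCast_mul, iterate_derivative_X_sub_pow, Nat.sub_sub_self hk]
  have e : n.descFactorial (n - k) * n.descFactorial k = n.factorial * n.choose k := by
    rw [Nat.descFactorial_eq_factorial_mul_choose n k,
      Nat.descFactorial_eq_factorial_mul_choose n (n - k), Nat.choose_symm hk,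
      ← Nat.choose_mul_factorial_mul_factorial hk]
    ring
  have e' : (n.descFactorial (n - k) : ℤ[X]) * n.descFactorial k
      = n.factorial * n.choose k := by exact_mod_cast e
  simp only [nsmul_eq_mul]
  linear_combination (n.choose k : ℤ[X]) * X ^ k * (X - C 1) ^ (n - k) * e'

theorem simons_ljunggren_13 (n : ℕ) (x : ℝ) :
    ∑ k ∈ Finset.range (n + 1),
      (n.choose k : ℝ) * ((n + k).choose k : ℝ) * (-1) ^ (n - k) * (x + 1) ^ k =
    ∑ k ∈ Finset.range (n + 1),
      (n.choose k : ℝ) ^ 2 * x ^ (n - k) * (x + 1) ^ k := by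
  have h := mul_left_cancel₀ (by exact_mod_cast n.factorial_ne_zero) (rodrigues_leibniz n)
  have h2 := congrArg (Polynomial.aeval (x + 1)) h
  simp [Polynomial.shiftedLegendre] at h2
  have s : ((-1 : ℝ) ^ n) * (-1) ^ n = 1 := by rw [← mul_pow]; simp
  have h3 := congrArg (fun t => (-1 : ℝ) ^ n * t) h2
  simp only [← mul_assoc, s, one_mul] at h3
  rw [← h3, Finset.mul_sum]
  refine Finset.sum_congr rfl fun k hk => ?_
  have hk : k ≤ n := by simpa [Nat.lt_succ_iff] using hk
  have c : (n + k).choose n = (n + k).choose k := Nat.choose_symm_add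
  have p : (-1 : ℝ) ^ (n - k) = (-1) ^ n * (-1) ^ k := by
    obtain ⟨m, rfl⟩ := Nat.exists_eq_add_of_le hk
    have s : ((-1 : ℝ) ^ k) * (-1) ^ k = 1 := by rw [← mul_pow]; simp
    rw [Nat.add_sub_cancel_left, pow_add]
    linear_combination -(-1 : ℝ) ^ m * s
  rw [c, p]
  ring
end

section
/- For every natural number n and every real number x, ∑_{k=0}^{n} C(n,k) · C(n+k,k) · x^k = ∑_{k=0}^{n} C(n,k)^2 · x^{n−k} · (x+1)^k. -/
open Finset

theorem slj_aux (n k j : ℕ) (hk : k ≤ n) :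
    n.choose k * k.choose j = n.choose j * (n - j).choose (n - k) := by
  rcases le_or_gt j k with h | h
  · rw [Nat.choose_mul h]
    congr 1
    rw [← Nat.choose_symm (show k - j ≤ n - j by omega)]
    congr 1
    omega
  · rw [Nat.choose_eq_zero_of_lt h]
    rcases le_or_gt j n with h' | h'
    · rw [Nat.choose_eq_zero_of_lt (show n - j < n - k by omega)]
      simp
    · rw [Nat.choose_eq_zero_of_lt h']
      simp

theorem slj_aux2 (n j : ℕ) (hj : j ≤ n) :
    ∑ k ∈ Finset.range (n + 1), n.choose k ^ 2 * k.choose j =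
      n.choose (n - j) * (n + (n - j)).choose (n - j) := by
  have h1 : (n + (n - j)).choose (n - j) = (n + (n - j)).choose n := by
    rw [Nat.choose_symm_add]
  rw [h1, Nat.choose_symm hj, Nat.add_choose_eq, Finset.Nat.sum_antidiagonal_eq_sum_range_succ_mk,
    Finset.mul_sum]
  refine Finset.sum_congr rfl fun k hk => ?_
  have hk' : k ≤ n := by simpa [Nat.lt_succ_iff] using hk
  have := slj_aux n k j hk'
  calc n.choose k ^ 2 * k.choose j = n.choose k * (n.choose k * k.choose j) := by ring
    _ = _ := by rw [this]; ring

theorem simons_ljunggren_14 (n : ℕ) (x : ℝ) :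
    ∑ k ∈ Finset.range (n + 1),
      (n.choose k : ℝ) * ((n + k).choose k : ℝ) * x ^ k =
    ∑ k ∈ Finset.range (n + 1),
      (n.choose k : ℝ) ^ 2 * x ^ (n - k) * (x + 1) ^ k := by
  have hR : ∀ k ∈ Finset.range (n + 1),
      (n.choose k : ℝ) ^ 2 * x ^ (n - k) * (x + 1) ^ k =
      ∑ j ∈ Finset.range (n + 1), ((n.choose k ^ 2 * k.choose j : ℕ) : ℝ) * x ^ (n - j) := by
    intro k hk
    have hk' : k < n + 1 := by simpa using hk
    rw [add_comm x 1, add_pow, Finset.mul_sum]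
    refine Finset.sum_subset_zero_on_sdiff (Finset.range_subset_range.2 (by omega)) ?_ ?_
    · intro j hj
      simp only [Finset.mem_sdiff, Finset.mem_range] at hj
      rw [Nat.choose_eq_zero_of_lt (show k < j by omega)]
      simp
    · intro j hj
      have hj' : j < k + 1 := by simpa using hj
      rw [show n - j = (n - k) + (k - j) by omega, pow_add]
      push_cast
      ring
  rw [Finset.sum_congr rfl hR, Finset.sum_comm, ← Finset.sum_range_reflect]
  refine Finset.sum_congr rfl fun j hj => ?_
  have hj' : j < n + 1 := by simpa using hj
  rw [← Finset.sum_mul, ← Nat.cast_sum, slj_aux2 n j (by omega),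
    show n + 1 - 1 - j = n - j by omega]
  push_cast
  ring
end

section
/- For all positive integers q and n with q ≥ n and all real numbers x, y, ∑_{k=0}^{n} C(n,k) · C(q+k,k) · x^k · y^{n−k} = ∑_{k=0}^{n} C(n,k) · C(q,k) · (x+y)^{n−k} · x^k. -/
open Finset

/-- Ljunggren's identity after the substitution `x - y → y`, `y → x`. -/
theorem ljunggren_identity_renamed (q n : ℕ) (hn : 0 < n) (hq : n ≤ q) (x y : ℝ) :
    ∑ k ∈ Finset.range (n + 1),
      (n.choose k : ℝ) * ((q + k).choose k : ℝ) * x ^ k * y ^ (n - k) =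
    ∑ k ∈ Finset.range (n + 1),
      (n.choose k : ℝ) * (q.choose k : ℝ) * (x + y) ^ (n - k) * x ^ k := by
  have flip := Finset.sum_range_diag_flip (n + 1) (fun j i : ℕ =>
    (n.choose (j + i) : ℝ) * (q.choose j : ℝ) * ((j + i).choose i : ℝ)
      * x ^ (j + i) * y ^ (n - (j + i)))
  refine Eq.trans ?_ (flip.trans ?_)
  · refine Finset.sum_congr rfl fun k _ => ?_
    rw [Nat.add_choose_eq, Finset.Nat.sum_antidiagonal_eq_sum_range_succ_mk]
    push_cast
    rw [Finset.mul_sum, Finset.sum_mul, Finset.sum_mul]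
    refine Finset.sum_congr rfl fun j hj => ?_
    have hjk : j + (k - j) = k := by
      have := Finset.mem_range.mp hj
      omega
    rw [hjk]
    ring
  · refine Finset.sum_congr rfl fun j hj => ?_
    have hjn : j ≤ n := by
      have := Finset.mem_range.mp hj
      omega
    have h1 : n + 1 - j = n - j + 1 := by omega
    rw [h1, add_pow, Finset.mul_sum, Finset.sum_mul]
    refine Finset.sum_congr rfl fun i hi => ?_
    have hin : i ≤ n - j := by
      have := Finset.mem_range.mp hi
      omega
    have h2 : n - (j + i) = n - j - i := by omega
    have key : (n.choose (j + i) : ℝ) * ((j + i).choose i : ℝ)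
        = (n.choose j : ℝ) * ((n - j).choose i : ℝ) := by
      have h := Nat.choose_mul (n := n) (k := j + i) (s := j) (by omega)
      rw [Nat.add_sub_cancel_left, Nat.choose_symm_add] at h
      exact_mod_cast h
    rw [h2, pow_add]
    linear_combination (q.choose j : ℝ) * x ^ j * x ^ i * y ^ (n - j - i) * key
end

section
/- For all positive integers q and n with q ≥ n and every real number z, ∑_{k=0}^{n} C(n,k) · C(q+k,k) · z^k = ∑_{k=0}^{n} C(n,k) · C(q,k) · (z+1)^{n−k} · z^k. -/
open Finset

lemma vander_aux (q m : ℕ) :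
    ((q + m).choose m : ℝ) = ∑ k ∈ Finset.range (m + 1), (q.choose k : ℝ) * (m.choose k : ℝ) := by
  rw [Nat.add_choose_eq, Finset.Nat.sum_antidiagonal_eq_sum_range_succ_mk]
  push_cast
  refine Finset.sum_congr rfl fun k hk => ?_
  rw [Nat.choose_symm (by simpa [Nat.lt_succ_iff] using hk)]

/-- One-variable form of Ljunggren's identity. -/
theorem ljunggren_identity_one_var (q n : ℕ) (hn : 0 < n) (hq : n ≤ q) (z : ℝ) :
    ∑ k ∈ Finset.range (n + 1),
      (n.choose k : ℝ) * ((q + k).choose k : ℝ) * z ^ k =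
    ∑ k ∈ Finset.range (n + 1),
      (n.choose k : ℝ) * (q.choose k : ℝ) * (z + 1) ^ (n - k) * z ^ k := by
  simp_rw [vander_aux, Finset.mul_sum, Finset.sum_mul]
  rw [Finset.sum_comm' (t' := Finset.range (n + 1)) (s' := fun k => Finset.Ico k (n + 1))
    (by intro x y; simp only [Finset.mem_range, Finset.mem_Ico]; omega)]
  refine Finset.sum_congr rfl fun k hk => ?_
  have hk' : k ≤ n := by simpa [Nat.lt_succ_iff] using hk
  rw [Finset.sum_Ico_eq_sum_range, add_pow, Finset.mul_sum, Finset.sum_mul,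
    show n + 1 - k = n - k + 1 by omega]
  refine Finset.sum_congr rfl fun j hj => ?_
  have h := Nat.choose_mul (n := n) (k := k + j) (s := k) (by omega)
  rw [Nat.add_sub_cancel_left] at h
  have h' : (n.choose (k + j) : ℝ) * ((k + j).choose k : ℝ)
      = (n.choose k : ℝ) * ((n - k).choose j : ℝ) := by exact_mod_cast h
  rw [pow_add, one_pow]
  linear_combination (q.choose k : ℝ) * z ^ k * z ^ j * h'
end

section
/- For every natural number n, the Legendre polynomial P_n satisfies P_n(x) = ∑_{k=0}^{n} C(n,k) · C(n+k,k) · ((x−1)/2)^k for every real number x, where P_n(x) = (1/(2^n · n!)) · (d/dx)^n (x^2 − 1)^n. -/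
open Finset Polynomial

/-- The Legendre polynomial defined by the Rodrigues formula:
`P_n = (2^n n!)⁻¹ • (d/dX)^[n] (X^2 - 1)^n`. -/
noncomputable def legendre (n : ℕ) : Polynomial ℝ :=
  ((2 ^ n * n.factorial : ℝ))⁻¹ • (Polynomial.derivative^[n] ((X ^ 2 - 1) ^ n))

theorem legendre_eq_sum (n : ℕ) (x : ℝ) :
    (legendre n).eval x =
      ∑ k ∈ Finset.range (n + 1),
        (n.choose k : ℝ) * ((n + k).choose k : ℝ) * ((x - 1) / 2) ^ k := by
  have h : ((X ^ 2 - 1) ^ n : Polynomial ℝ) =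
      ∑ k ∈ Finset.range (n + 1),
        C ((n.choose k : ℝ) * 2 ^ (n - k)) * (X - C 1) ^ (n + k) := by
    have h1 : (X ^ 2 - 1 : Polynomial ℝ) = (X - C 1) * ((X - C 1) + C 2) := by
      have h2 : (C 2 : Polynomial ℝ) = 2 := rfl
      rw [h2, C_1]
      ring
    rw [h1, mul_pow, add_pow, Finset.mul_sum]
    refine Finset.sum_congr rfl fun k _ => ?_
    rw [C_mul, C_pow, pow_add, C_eq_natCast]
    ring
  rw [legendre, h, iterate_derivative_sum, eval_smul, eval_finset_sum, smul_eq_mul,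
    Finset.mul_sum]
  refine Finset.sum_congr rfl fun k hk => ?_
  have hk' : k ≤ n := by
    have := Finset.mem_range.mp hk
    omega
  rw [iterate_derivative_C_mul, iterate_derivative_X_sub_pow, Nat.add_sub_cancel_left,
    Nat.descFactorial_eq_factorial_mul_choose, Nat.choose_symm_add]
  have h2 : (2 : ℝ) ^ n = 2 ^ (n - k) * 2 ^ k := by
    rw [← pow_add, Nat.sub_add_cancel hk']
  have h3 : (n.factorial : ℝ) ≠ 0 := by
    exact_mod_cast n.factorial_ne_zero
  simp only [eval_mul, eval_C, eval_smul, eval_pow, eval_sub, eval_X, nsmul_eq_mul,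
    Nat.cast_mul, div_pow, h2, eval_natCast]
  field_simp
end

section
/- For every natural number n, the Legendre polynomial P_n satisfies P_n(x) = ∑_{k=0}^{n} C(n,k) · C(n+k,k) · (−1)^{n−k} · ((x+1)/2)^k for every real number x, where P_n(x) = (1/(2^n · n!)) · (d/dx)^n (x^2 − 1)^n. -/
open Finset Polynomial

lemma legendre_aux (n : ℕ) : ((X ^ 2 - 1) ^ n : ℝ[X]) =
    ∑ k ∈ Finset.range (n + 1),
      C ((n.choose k : ℝ) * (-2) ^ (n - k)) * (X + C 1) ^ (n + k) := by
  have h : (X ^ 2 - 1 : ℝ[X]) = (X + C 1) * ((X + C 1) + C (-2)) := by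
    simp only [map_neg, map_ofNat, map_one]
    ring
  rw [h, mul_pow, add_pow (X + C 1) (C (-2)), Finset.mul_sum]
  refine Finset.sum_congr rfl fun k _ => ?_
  simp only [C_mul, C_pow, pow_add, map_natCast]
  ring

theorem legendre_eq_sum' (n : ℕ) (x : ℝ) :
    (legendre n).eval x =
      ∑ k ∈ Finset.range (n + 1),
        (n.choose k : ℝ) * ((n + k).choose k : ℝ) * (-1) ^ (n - k) * ((x + 1) / 2) ^ k := by
  rw [legendre, legendre_aux, iterate_derivative_sum, eval_smul, eval_finsetSum,
    smul_eq_mul, Finset.mul_sum]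
  refine Finset.sum_congr rfl fun k hk => ?_
  have hk' : k ≤ n := Nat.lt_succ_iff.mp (Finset.mem_range.mp hk)
  rw [iterate_derivative_C_mul, iterate_derivative_X_add_pow, Nat.add_sub_cancel_left,
    Nat.descFactorial_eq_factorial_mul_choose, Nat.choose_symm_add]
  have hf : (n.factorial : ℝ) ≠ 0 := by exact_mod_cast n.factorial_ne_zero
  have h2 : (2 : ℝ) ^ n = 2 ^ (n - k) * 2 ^ k := by rw [← pow_add, Nat.sub_add_cancel hk']
  have h3 : (-2 : ℝ) ^ (n - k) = (-1) ^ (n - k) * 2 ^ (n - k) := by rw [← mul_pow]; norm_num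
  simp only [eval_mul, eval_C, eval_smul, eval_pow, eval_add, eval_X, nsmul_eq_mul, eval_natCast]
  rw [h2, h3, div_pow]
  push_cast
  field_simp
end

section
/- For every natural number n and every real number x with x ≠ 1, the Legendre polynomial P_n satisfies P_n(x) = ((x−1)/2)^n · ∑_{k=0}^{n} C(n,k)^2 · ((x+1)/(x−1))^k, where P_n(x) = (1/(2^n · n!)) · (d/dx)^n (x^2 − 1)^n. -/
open Finset Polynomial

theorem legendre_eq_sum'' (n : ℕ) (x : ℝ) (hx : x ≠ 1) :
    (legendre n).eval x =
      ((x - 1) / 2) ^ n *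
        ∑ k ∈ Finset.range (n + 1),
          (n.choose k : ℝ) ^ 2 * ((x + 1) / (x - 1)) ^ k := by
  have hx' : x - 1 ≠ 0 := sub_ne_zero.mpr hx
  have hfac : ((X : Polynomial ℝ) ^ 2 - 1) ^ n = (X + C 1) ^ n * (X - C 1) ^ n := by
    rw [← mul_pow]
    congr 1
    simp only [map_one]
    ring
  rw [legendre, hfac, iterate_derivative_mul, eval_smul, eval_finset_sum, smul_eq_mul,
    Finset.mul_sum, Finset.mul_sum]
  refine Finset.sum_congr rfl fun k hk => ?_
  have hk : k ≤ n := Nat.lt_succ_iff.mp (Finset.mem_range.mp hk)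
  rw [iterate_derivative_X_add_pow, iterate_derivative_X_sub_pow, Nat.sub_sub_self hk]
  have h1 : (n.descFactorial (n - k) : ℝ) = (n - k).factorial * n.choose k := by
    rw [Nat.descFactorial_eq_factorial_mul_choose, Nat.choose_symm hk]
    push_cast
    rfl
  have h2 : (n.descFactorial k : ℝ) = k.factorial * n.choose k := by
    rw [Nat.descFactorial_eq_factorial_mul_choose]
    push_cast
    rfl
  have h3 : (n.factorial : ℝ) = n.choose k * k.factorial * (n - k).factorial := by
    exact_mod_cast (Nat.choose_mul_factorial_mul_factorial hk).symm
  have h4 : (n.factorial : ℝ) ≠ 0 := by exact_mod_cast n.factorial_ne_zero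
  have h5 : (x - 1) ^ n = (x - 1) ^ (n - k) * (x - 1) ^ k := by
    rw [← pow_add, Nat.sub_add_cancel hk]
  simp only [nsmul_eq_mul, eval_mul, eval_natCast, eval_pow, eval_add, eval_sub, eval_X, eval_C]
  rw [h1, h2, div_pow, div_pow, h5]
  field_simp
  rw [h3]
  ring
end

section
/- For all real numbers α, β, x, y and every natural number n, ∑_{k=0}^{n} B(α,n−k) · B(β+k,k) · x^k · y^{n−k} = ∑_{k=0}^{n} B(β−α+n,n−k) · B(β+k,k) · (−y)^{n−k} · (x+y)^k. -/
open Finset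

theorem choose_neg_real (a b : ℝ) (k : ℕ) (h : b = -a + k - 1) :
    Ring.choose a k = (-1) ^ k * Ring.choose b k := by
  have := Ring.choose_neg (-a) k
  rw [neg_neg] at this
  rw [this, h, Units.smul_def, zsmul_eq_mul]
  simp [Int.negOnePow_def]

/-- Munarini's first identity. -/
theorem munarini_first (α β x y : ℝ) (n : ℕ) :
    ∑ k ∈ Finset.range (n + 1),
      genBinom α (n - k) * genBinom (β + k) k * x ^ k * y ^ (n - k) =
    ∑ k ∈ Finset.range (n + 1),
      genBinom (β - α + n) (n - k) * genBinom (β + k) k * (-y) ^ (n - k) * (x + y) ^ k := by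
  simp only [genBinom_eq_choose]
  rw [← Finset.Nat.sum_antidiagonal_eq_sum_range_succ (fun k l =>
      Ring.choose α l * Ring.choose (β + k) k * x ^ k * y ^ l) n,
    ← Finset.Nat.sum_antidiagonal_eq_sum_range_succ (fun k l =>
      Ring.choose (β - α + n) l * Ring.choose (β + k) k * (-y) ^ l * (x + y) ^ k) n]
  have hL : ∀ p ∈ antidiagonal n,
      Ring.choose α p.2 * Ring.choose (β + p.1) p.1 * x ^ p.1 * y ^ p.2 =
      ∑ q ∈ antidiagonal p.2, (-1) ^ p.2 * (Ring.choose (-β - p.1 - 1) q.1 *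
        Ring.choose (β - α + n) q.2) * Ring.choose (β + p.1) p.1 * x ^ p.1 * y ^ p.2 := by
    rintro ⟨j, N⟩ hp
    have hn : j + N = n := by simpa using hp
    simp only
    rw [← Finset.sum_mul, ← Finset.sum_mul, ← Finset.sum_mul, ← Finset.mul_sum,
      ← Ring.add_choose_eq N (Commute.all _ _), ← choose_neg_real]
    rw [← hn]; push_cast; ring
  have hR : ∀ p ∈ antidiagonal n,
      Ring.choose (β - α + n) p.2 * Ring.choose (β + p.1) p.1 * (-y) ^ p.2 * (x + y) ^ p.1 =
      ∑ q ∈ antidiagonal p.1, Ring.choose (β - α + n) p.2 * Ring.choose (β + p.1) p.1 * (-y) ^ p.2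
        * (p.1.choose q.1 • (x ^ q.1 * y ^ q.2)) := by
    intro p hp
    rw [← Finset.mul_sum, (Commute.all x y).add_pow']
  rw [Finset.sum_congr rfl hL, Finset.sum_congr rfl hR, Finset.sum_sigma', Finset.sum_sigma']
  refine Finset.sum_bij' (fun a _ => ⟨(a.1.1 + a.2.1, a.2.2), (a.1.1, a.2.1)⟩)
    (fun a _ => ⟨(a.2.1, a.2.2 + a.1.2), (a.2.2, a.1.2)⟩) ?_ ?_ ?_ ?_ ?_
  · rintro ⟨⟨a, b⟩, ⟨c, d⟩⟩ h
    simp at h ⊢; omega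
  · rintro ⟨⟨a, b⟩, ⟨c, d⟩⟩ h
    simp at h ⊢; omega
  · rintro ⟨⟨a, b⟩, ⟨c, d⟩⟩ h
    simp at h ⊢; omega
  · rintro ⟨⟨a, b⟩, ⟨c, d⟩⟩ h
    simp at h ⊢; omega
  · rintro ⟨⟨j, N⟩, ⟨m, l⟩⟩ h
    obtain ⟨h1, h2⟩ : j + N = n ∧ m + l = N := by simpa using h
    have hA := Ring.choose_add_smul_choose (β + j) j m
    rw [Nat.choose_symm_add.symm, nsmul_eq_mul] at hA
    have hB := choose_neg_real (-β - j - 1) (β + j + m) m (by ring)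
    have hs : ((-1 : ℝ) ^ m) * (-1) ^ m = 1 := by rw [← mul_pow]; simp
    simp only [nsmul_eq_mul]
    rw [hB, neg_pow y, ← h2, pow_add, pow_add]
    push_cast
    rw [← add_assoc]
    linear_combination ((-1) ^ l * Ring.choose (β - α + n) l * Ring.choose (β + j) j *
      Ring.choose (β + j + m) m * x ^ j * y ^ m * y ^ l) * hs -
      ((-1) ^ l * Ring.choose (β - α + n) l * x ^ j * y ^ m * y ^ l) * hA
end
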